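/- A closed λ-term T is a storage operator for the integers if and only if for every n ≥ 0 there exists a finite sequence of head reductions {U_i ≻ V_i}_{1≤i≤r} with: U₁ = (T)νf and V_r = (f)τₙ with τₙ ≃_β n̲; each V_i is of the form (ν)a b c̄ or (x_{l,a,b,c̄})d̄ with 0 ≤ l ≤ n−1; if V_i = (ν)a b c̄ then U_{i+1} = (a)c̄ when n = 0 and U_{i+1} = ((b)x_{n−1,a,b,c̄})c̄ when n ≠ 0; and if V_i = (x_{l,a,b,c̄})d̄ then U_{i+1} = (a)d̄ when l = 0 and U_{i+1} = ((b)x_{l−1,a,b,d̄})d̄ when l ≠ 0. -/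

import Mathlib

/- Untyped λ-calculus with de Bruijn indices, head reduction, Church numerals. -/

inductive Lam : Type
  | var : ℕ → Lam
  | app : Lam → Lam → Lam
  | lam : Lam → Lam
deriving DecidableEq, Repr

namespace Lam

/-- Shift free variables `≥ c` up by 1. -/
def lift (c : ℕ) : Lam → Lam
  | var n => if n < c then var n else var (n + 1)
  | app s t => app (s.lift c) (t.lift c)
  | lam t => lam (t.lift (c + 1))

/-- Push a substitution under a binder. -/
def up (σ : ℕ → Lam) : ℕ → Lam
  | 0 => var 0
  | n + 1 => (σ n).lift 0

/-- Capture-avoiding simultaneous substitution. -/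
def subst (σ : ℕ → Lam) : Lam → Lam
  | var n => σ n
  | app s t => app (s.subst σ) (t.subst σ)
  | lam t => lam (t.subst (up σ))

/-- `t.subst0 u` is `t[u/0]`, the β-contractum substitution. -/
def subst0 (t u : Lam) : Lam :=
  t.subst (fun n => match n with | 0 => u | n + 1 => var n)

/-- `m` occurs free in the term. -/
def FreeIn (m : ℕ) : Lam → Prop
  | var n => n = m
  | app s t => s.FreeIn m ∨ t.FreeIn m
  | lam t => t.FreeIn (m + 1)

/-- A closed λ-term. -/
def Closed (t : Lam) : Prop := ∀ m, ¬ t.FreeIn m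

end Lam

/-- One-step β-reduction (anywhere in the term). -/
inductive Beta : Lam → Lam → Prop
  | beta (t u) : Beta (.app (.lam t) u) (t.subst0 u)
  | appL {s s'} (t) : Beta s s' → Beta (.app s t) (.app s' t)
  | appR {t t'} (s) : Beta t t' → Beta (.app s t) (.app s t')
  | lam {t t'} : Beta t t' → Beta (.lam t) (.lam t')

/-- β-equivalence `≃β`. -/
def BetaEq : Lam → Lam → Prop := Relation.EqvGen Beta

/-- A term in (β-)normal form. -/
def NormalForm (t : Lam) : Prop := ∀ u, ¬ Beta t u

/-- One step of head reduction: reduce the head redex. -/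
inductive HStep : Lam → Lam → Prop
  | beta (t u) : HStep (.app (.lam t) u) (t.subst0 u)
  | lam {t t'} : HStep t t' → HStep (.lam t) (.lam t')
  | app {t t'} (u) : HStep t t' → (∀ s, t ≠ .lam s) → HStep (.app t u) (.app t' u)

/-- `HRedN k u v` : `u ≻ v` by a head reduction of length `h(u,v) = k`. -/
inductive HRedN : ℕ → Lam → Lam → Prop
  | refl (t) : HRedN 0 t t
  | step {k t u v} : HStep t u → HRedN k u v → HRedN (k + 1) t v

/-- `u ≻ v` : `v` is obtained from `u` by head reduction. -/
def HRed (t u : Lam) : Prop := ∃ k, HRedN k t u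

/-- Head normal form: no head redex. -/
def HeadNormal (t : Lam) : Prop := ∀ u, ¬ HStep t u

/-- Solvable: the head reduction terminates. -/
def Solvable (t : Lam) : Prop := ∃ v, HRed t v ∧ HeadNormal v

/-- `(t)u₁…uₙ` : iterated application. -/
def appList : Lam → List Lam → Lam
  | t, [] => t
  | t, u :: us => appList (t.app u) us

/-- `(f)ⁿ x` with `x = var 1`, `f = var 0`. -/
def churchBody : ℕ → Lam
  | 0 => .var 1
  | n + 1 => .app (.var 0) (churchBody n)

/-- Church numeral `n̲ = λx λf (f)ⁿ x`. -/
def church (n : ℕ) : Lam := .lam (.lam (churchBody n))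

/-- `0̲ = λx λf x`. -/
def czero : Lam := .lam (.lam (.var 1))

/-- `s̲ = λn λx λf (f)((n)x)f`. -/
def csucc : Lam := .lam (.lam (.lam (.app (.var 0) (.app (.app (.var 2) (.var 1)) (.var 0)))))

/-- `(s̲)ⁿ 0̲`. -/
def succIter : ℕ → Lam
  | 0 => czero
  | n + 1 => .app csucc (succIter n)

/-- `G = λx λy (x) λz (y)(s̲)z`. -/
def Gop : Lam := .lam (.lam (.app (.var 1) (.lam (.app (.var 1) (.app csucc (.var 0))))))

/-- `δ = λf (f)0̲`. -/
def deltaOp : Lam := .lam (.app (.var 0) czero)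

/-- `T₁ = λn ((n)δ)G`. -/
def T1 : Lam := .lam (.app (.app (.var 0) deltaOp) Gop)

/-- `F = λx λy (x)(s̲)y`. -/
def Fop : Lam := .lam (.lam (.app (.var 1) (.app csucc (.var 0))))

/-- `T₂ = λn λf (((n)f)F)0̲`. -/
def T2 : Lam := .lam (.lam (.app (.app (.app (.var 1) (.var 0)) Fop) czero))

/-- `θ₀ = λx λf λz (x)(λd z)(λx x)`. -/
def theta0 : Lam := .lam (.lam (.lam (.app (.app (.var 2) (.lam (.var 1))) (.lam (.var 0)))))

/-- `T` is a storage operator for the integers (the fixed variable `f` is `var 0`). -/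
def IsStorage (T : Lam) : Prop :=
  ∀ n : ℕ, ∃ τ : Lam, BetaEq τ (church n) ∧
    ∀ θ : Lam, BetaEq θ (church n) →
      ∃ σ : ℕ → Lam, HRed (.app (.app T θ) (.var 0)) (.app (.var 0) (τ.subst σ))

namespace Lam

/-- Push a renaming under a binder. -/
def upRen (ξ : ℕ → ℕ) : ℕ → ℕ
  | 0 => 0
  | n + 1 => ξ n + 1

/-- Renaming of free variables. -/
def ren (ξ : ℕ → ℕ) : Lam → Lam
  | var n => var (ξ n)
  | app s t => app (s.ren ξ) (t.ren ξ)
  | lam t => lam (t.ren (upRen ξ))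

/-- The substitution replacing the variable `0` by `u` and lowering the other variables. -/
def inst (u : Lam) : ℕ → Lam
  | 0 => u
  | n + 1 => var n

theorem subst0_eq_subst_inst (t u : Lam) : t.subst0 u = t.subst (inst u) := by
  unfold subst0
  congr 1

theorem lift_eq_ren (c : ℕ) (t : Lam) :
    t.lift c = t.ren (fun n => if n < c then n else n + 1) := by
  induction t generalizing c with
  | var n => simp only [lift, ren]; split_ifs <;> rfl
  | app s t ihs iht => simp only [lift, ren, ihs, iht]
  | lam t ih =>
    simp only [lift, ren, ih]
    congr 2
    funext n
    cases n with
    | zero => simp [upRen]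
    | succ n => simp only [upRen, Nat.add_lt_add_iff_right]; split_ifs <;> rfl

theorem lift_zero (t : Lam) : t.lift 0 = t.ren (· + 1) := by
  simp [lift_eq_ren]

theorem up_var_comp (ξ : ℕ → ℕ) : up (fun n => var (ξ n)) = fun n => var (upRen ξ n) := by
  funext n
  cases n <;> simp [up, upRen, lift]

theorem ren_eq_subst (ξ : ℕ → ℕ) (t : Lam) : t.ren ξ = t.subst (fun n => var (ξ n)) := by
  induction t generalizing ξ with
  | var n => rfl
  | app s t ihs iht => simp only [ren, subst, ihs, iht]
  | lam t ih => simp only [ren, subst, ih, up_var_comp]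

theorem subst_ren (ξ : ℕ → ℕ) (σ : ℕ → Lam) (t : Lam) :
    (t.ren ξ).subst σ = t.subst (fun n => σ (ξ n)) := by
  induction t generalizing ξ σ with
  | var n => rfl
  | app s t ihs iht => simp only [ren, subst, ihs, iht]
  | lam t ih =>
    simp only [ren, subst, ih]
    congr 2
    funext n
    cases n <;> rfl

theorem ren_ren (ξ ζ : ℕ → ℕ) (t : Lam) : (t.ren ξ).ren ζ = t.ren (fun n => ζ (ξ n)) := by
  rw [ren_eq_subst ζ, subst_ren, ← ren_eq_subst (fun n => ζ (ξ n))]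

theorem ren_subst (ξ : ℕ → ℕ) (σ : ℕ → Lam) (t : Lam) :
    (t.subst σ).ren ξ = t.subst (fun n => (σ n).ren ξ) := by
  induction t generalizing ξ σ with
  | var n => rfl
  | app s t ihs iht => simp only [ren, subst, ihs, iht]
  | lam t ih =>
    simp only [ren, subst, ih]
    congr 2
    funext n
    cases n with
    | zero => rfl
    | succ n => simp only [up, lift_zero, ren_ren, upRen]

theorem subst_subst (σ ρ : ℕ → Lam) (t : Lam) :
    (t.subst σ).subst ρ = t.subst (fun n => (σ n).subst ρ) := by
  induction t generalizing σ ρ with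
  | var n => rfl
  | app s t ihs iht => simp only [subst, ihs, iht]
  | lam t ih =>
    simp only [subst, ih]
    congr 2
    funext n
    cases n with
    | zero => rfl
    | succ n => simp only [up, lift_zero, subst_ren, ren_subst]

theorem up_var : up var = var := by
  funext n
  cases n <;> simp [up, lift]

theorem subst_var (t : Lam) : t.subst var = t := by
  induction t with
  | var n => rfl
  | app s t ihs iht => simp only [subst, ihs, iht]
  | lam t ih => simp only [subst, up_var, ih]

theorem subst_up_subst0 (σ : ℕ → Lam) (t u : Lam) :
    (t.subst (up σ)).subst0 u = t.subst (fun n => match n with | 0 => u | n + 1 => σ n) := by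
  rw [subst0_eq_subst_inst, subst_subst]
  congr 1
  funext n
  cases n with
  | zero => rfl
  | succ n => simp only [up, lift_zero, subst_ren, inst]; exact subst_var _

theorem subst0_subst (σ : ℕ → Lam) (t u : Lam) :
    (t.subst0 u).subst σ = (t.subst (up σ)).subst0 (u.subst σ) := by
  rw [subst_up_subst0, subst0, subst_subst]
  congr 1
  funext n
  cases n <;> rfl

theorem subst_congr {σ ρ : ℕ → Lam} {t : Lam} (h : ∀ m, t.FreeIn m → σ m = ρ m) :
    t.subst σ = t.subst ρ := by
  induction t generalizing σ ρ with
  | var n => exact h n rfl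
  | app s t ihs iht =>
    simp only [subst, ihs fun m hm => h m (Or.inl hm), iht fun m hm => h m (Or.inr hm)]
  | lam t ih =>
    simp only [subst]
    rw [ih]
    intro m hm
    cases m with
    | zero => rfl
    | succ m => simp only [up, h m hm]

theorem Closed.subst_eq {t : Lam} (ht : t.Closed) (σ : ℕ → Lam) : t.subst σ = t := by
  rw [subst_congr (ρ := var) fun m hm => (ht m hm).elim, subst_var]

theorem FreeIn.of_ren {m : ℕ} {ξ : ℕ → ℕ} {t : Lam} (h : (t.ren ξ).FreeIn m) :
    ∃ i, t.FreeIn i ∧ ξ i = m := by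
  induction t generalizing m ξ with
  | var n => exact ⟨n, rfl, h⟩
  | app s t ihs iht =>
    rcases h with h | h
    · obtain ⟨i, hi, e⟩ := ihs h
      exact ⟨i, Or.inl hi, e⟩
    · obtain ⟨i, hi, e⟩ := iht h
      exact ⟨i, Or.inr hi, e⟩
  | lam t ih =>
    obtain ⟨i, hi, e⟩ := ih h
    cases i with
    | zero => simp [upRen] at e
    | succ i => exact ⟨i, hi, by simpa [upRen] using e⟩

theorem FreeIn.of_subst {m : ℕ} {σ : ℕ → Lam} {t : Lam} (h : (t.subst σ).FreeIn m) :
    ∃ i, t.FreeIn i ∧ (σ i).FreeIn m := by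
  induction t generalizing m σ with
  | var n => exact ⟨n, rfl, h⟩
  | app s t ihs iht =>
    rcases h with h | h
    · obtain ⟨i, hi, e⟩ := ihs h
      exact ⟨i, Or.inl hi, e⟩
    · obtain ⟨i, hi, e⟩ := iht h
      exact ⟨i, Or.inr hi, e⟩
  | lam t ih =>
    obtain ⟨i, hi, e⟩ := ih h
    cases i with
    | zero => simp [up, FreeIn] at e
    | succ i =>
      simp only [up, lift_zero] at e
      obtain ⟨j, hj, e⟩ := e.of_ren
      obtain rfl : j = m := by simpa using e
      exact ⟨i, hi, hj⟩

end Lam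

open Relation

/-! ### Weak head reduction -/

/-- One step of weak head reduction. -/
inductive WStep : Lam → Lam → Prop
  | beta (t u) : WStep (.app (.lam t) u) (t.subst0 u)
  | app {t t'} (u) : WStep t t' → WStep (.app t u) (.app t' u)

/-- Weak head reduction. -/
abbrev WRed : Lam → Lam → Prop := ReflTransGen WStep

namespace WStep

theorem not_lam {t u : Lam} (h : WStep t u) (s : Lam) : t ≠ .lam s := by
  cases h <;> simp

theorem hStep {t u : Lam} (h : WStep t u) : HStep t u := by
  induction h with
  | beta t u => exact .beta t u
  | app u h ih => exact .app u ih h.not_lam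

theorem beta_step {t u : Lam} (h : WStep t u) : Beta t u := by
  induction h with
  | beta t u => exact .beta t u
  | app u _ ih => exact .appL u ih

theorem subst {t u : Lam} (h : WStep t u) (σ : ℕ → Lam) : WStep (t.subst σ) (u.subst σ) := by
  induction h with
  | beta t u => rw [Lam.subst0_subst]; exact .beta _ _
  | app u _ ih => exact .app _ ih

theorem deterministic {t u v : Lam} (hu : WStep t u) (hv : WStep t v) : u = v := by
  induction hu generalizing v with
  | beta t u =>
    cases hv with
    | beta => rfl
    | app _ h => exact (h.not_lam _ rfl).elim
  | app u h ih =>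
    cases hv with
    | beta => exact (h.not_lam _ rfl).elim
    | app _ h' => rw [ih h']

theorem freeIn {t u : Lam} (h : WStep t u) {m : ℕ} (hm : u.FreeIn m) : t.FreeIn m := by
  induction h with
  | beta t u =>
    rw [Lam.subst0_eq_subst_inst] at hm
    obtain ⟨i, hi, e⟩ := hm.of_subst
    cases i with
    | zero => exact Or.inr e
    | succ i =>
      obtain rfl : i = m := e
      exact Or.inl hi
  | app u _ ih => exact hm.imp_left ih

end WStep

theorem HStep.wStep {t u : Lam} (h : HStep t u) (ht : ∀ s, t ≠ .lam s) : WStep t u := by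
  induction h with
  | beta t u => exact .beta t u
  | lam _ _ => exact (ht _ rfl).elim
  | app u _ hn ih => exact .app u (ih hn)

theorem HRedN.exists_lam {k : ℕ} {s v : Lam} (h : HRedN k (.lam s) v) : ∃ s', v = .lam s' := by
  generalize ht : Lam.lam s = t at h
  induction h generalizing s with
  | refl t => exact ⟨s, ht.symm⟩
  | step h _ ih =>
    subst ht
    cases h with
    | lam h => exact ih rfl

/-- Head reductions that do not end on an abstraction are weak head reductions. -/
theorem HRed.wRed {t u : Lam} (h : HRed t u) (hu : ∀ s, u ≠ .lam s) : WRed t u := by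
  obtain ⟨k, h⟩ := h
  induction h with
  | refl t => exact .refl
  | @step k t v u h h' ih =>
    refine .head (h.wStep ?_) (ih hu)
    rintro s rfl
    obtain ⟨s', e⟩ := (HRedN.step h h').exists_lam
    exact hu s' e

namespace WRed

theorem hRed {t u : Lam} (h : WRed t u) : HRed t u := by
  induction h using ReflTransGen.head_induction_on with
  | refl => exact ⟨0, .refl _⟩
  | head h _ ih =>
    obtain ⟨k, hk⟩ := ih
    exact ⟨k + 1, .step h.hStep hk⟩

theorem subst {t u : Lam} (h : WRed t u) (σ : ℕ → Lam) : WRed (t.subst σ) (u.subst σ) :=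
  h.lift (·.subst σ) fun _ _ h => h.subst σ

theorem app {t u : Lam} (h : WRed t u) (v : Lam) : WRed (t.app v) (u.app v) :=
  h.lift (·.app v) fun _ _ h => h.app v

theorem freeIn {t u : Lam} (h : WRed t u) {m : ℕ} (hm : u.FreeIn m) : t.FreeIn m := by
  induction h with
  | refl => exact hm
  | tail _ h ih => exact ih (h.freeIn hm)

theorem of_normal {t u v : Lam} (hu : WRed t u) (hv : WRed t v) (hn : ∀ w, ¬ WStep v w) :
    WRed u v := by
  induction hu with
  | refl => exact hv
  | tail _ h ih =>
    rcases ih.cases_head with rfl | ⟨w, hw, h'⟩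
    · exact (hn _ h).elim
    · rwa [h.deterministic hw]

theorem acc {t u : Lam} (h : WRed t u) (hn : ∀ w, ¬ WStep u w) :
    Acc (fun b a => WStep a b) t := by
  induction h using ReflTransGen.head_induction_on with
  | refl => exact ⟨_, fun w hw => (hn w hw).elim⟩
  | head h _ ih => exact ⟨_, fun w hw => h.deterministic hw ▸ ih⟩

end WRed

/-! ### Standardization -/

/-- Standard reduction. -/
inductive Std : Lam → Lam → Prop
  | var {t} (n) : WRed t (.var n) → Std t (.var n)
  | app {t a b a' b'} : WRed t (.app a b) → Std a a' → Std b b' → Std t (.app a' b')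
  | lam {t a a'} : WRed t (.lam a) → Std a a' → Std t (.lam a')

namespace Std

theorem refl (t : Lam) : Std t t := by
  induction t with
  | var n => exact .var n .refl
  | app s t ihs iht => exact .app .refl ihs iht
  | lam t ih => exact .lam .refl ih

theorem head {t s u : Lam} (h : WRed t s) (hs : Std s u) : Std t u := by
  cases hs with
  | var n h' => exact .var n (h.trans h')
  | app h' ha hb => exact .app (h.trans h') ha hb
  | lam h' ha => exact .lam (h.trans h') ha

theorem ren {t u : Lam} (h : Std t u) (ξ : ℕ → ℕ) : Std (t.ren ξ) (u.ren ξ) := by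
  have hw : ∀ {t u : Lam} (ξ : ℕ → ℕ), WRed t u → WRed (t.ren ξ) (u.ren ξ) := by
    intro t u ξ h
    rw [Lam.ren_eq_subst, Lam.ren_eq_subst]
    exact h.subst _
  induction h generalizing ξ with
  | var n h => exact .var _ (hw ξ h)
  | app h _ _ iha ihb => exact .app (hw ξ h) (iha ξ) (ihb ξ)
  | lam h _ ih => exact .lam (hw ξ h) (ih _)

theorem subst {t u : Lam} (h : Std t u) {σ ρ : ℕ → Lam} (hσ : ∀ n, Std (σ n) (ρ n)) :
    Std (t.subst σ) (u.subst ρ) := by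
  induction h generalizing σ ρ with
  | var n h => exact head (h.subst σ) (hσ n)
  | app h _ _ iha ihb => exact .app (h.subst σ) (iha hσ) (ihb hσ)
  | lam h _ ih =>
    refine .lam (h.subst σ) (ih fun n => ?_)
    cases n with
    | zero => exact .refl _
    | succ n => simp only [Lam.up, Lam.lift_zero]; exact (hσ n).ren _

theorem tail {t u v : Lam} (h : Std t u) (hb : Beta u v) : Std t v := by
  induction hb generalizing t with
  | beta a b =>
    cases h with
    | app h hp hq =>
      cases hp with
      | lam hp ha =>
        refine head ((h.trans (hp.app _)).tail (.beta _ _)) ?_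
        rw [Lam.subst0_eq_subst_inst, Lam.subst0_eq_subst_inst]
        refine ha.subst fun n => ?_
        cases n with
        | zero => exact hq
        | succ n => exact .refl _
  | appL _ _ ih => cases h with | app h ha hb => exact .app h (ih ha) hb
  | appR _ _ ih => cases h with | app h ha hb => exact .app h ha (ih hb)
  | lam _ ih => cases h with | lam h ha => exact .lam h (ih ha)

theorem of_beta {t u : Lam} (h : ReflTransGen Beta t u) : Std t u := by
  induction h with
  | refl => exact .refl t
  | tail _ h ih => exact ih.tail h

end Std

/-! ### Confluence -/

/-- Parallel reduction. -/
inductive Par : Lam → Lam → Prop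
  | var (n) : Par (.var n) (.var n)
  | app {s s' t t'} : Par s s' → Par t t' → Par (.app s t) (.app s' t')
  | lam {t t'} : Par t t' → Par (.lam t) (.lam t')
  | beta {s s' t t'} : Par s s' → Par t t' → Par (.app (.lam s) t) (s'.subst0 t')

/-- Complete development of a term. -/
def Lam.develop : Lam → Lam
  | var n => var n
  | lam t => lam t.develop
  | app (lam s) t => s.develop.subst0 t.develop
  | app s t => app s.develop t.develop

namespace Par

theorem refl (t : Lam) : Par t t := by
  induction t with
  | var n => exact .var n
  | app s t ihs iht => exact .app ihs iht
  | lam t ih => exact .lam ih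

theorem of_beta {t u : Lam} (h : Beta t u) : Par t u := by
  induction h with
  | beta t u => exact .beta (.refl t) (.refl u)
  | appL t _ ih => exact .app ih (.refl t)
  | appR s _ ih => exact .app (.refl s) ih
  | lam _ ih => exact .lam ih

theorem ren {t u : Lam} (h : Par t u) (ξ : ℕ → ℕ) : Par (t.ren ξ) (u.ren ξ) := by
  induction h generalizing ξ with
  | var n => exact .refl _
  | app _ _ ihs iht => exact .app (ihs ξ) (iht ξ)
  | lam _ ih => exact .lam (ih _)
  | @beta s s' t t' _ _ ihs iht =>
    have h := Par.beta (ihs (Lam.upRen ξ)) (iht ξ)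
    rw [Lam.ren_eq_subst ξ (s'.subst0 t'), Lam.subst0_subst, Lam.up_var_comp,
      ← Lam.ren_eq_subst, ← Lam.ren_eq_subst]
    exact h

theorem subst {t u : Lam} (h : Par t u) {σ ρ : ℕ → Lam} (hσ : ∀ n, Par (σ n) (ρ n)) :
    Par (t.subst σ) (u.subst ρ) := by
  have hup : ∀ {σ ρ : ℕ → Lam}, (∀ n, Par (σ n) (ρ n)) →
      ∀ n, Par (Lam.up σ n) (Lam.up ρ n) := by
    intro σ ρ hσ n
    cases n with
    | zero => exact .refl _
    | succ n => simp only [Lam.up, Lam.lift_zero]; exact (hσ n).ren _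
  induction h generalizing σ ρ with
  | var n => exact hσ n
  | app _ _ ihs iht => exact .app (ihs hσ) (iht hσ)
  | lam _ ih => exact .lam (ih (hup hσ))
  | beta _ _ ihs iht =>
    rw [Lam.subst0_subst]
    exact .beta (ihs (hup hσ)) (iht hσ)

theorem subst0 {s s' t t' : Lam} (hs : Par s s') (ht : Par t t') :
    Par (s.subst0 t) (s'.subst0 t') := by
  rw [Lam.subst0_eq_subst_inst, Lam.subst0_eq_subst_inst]
  refine hs.subst fun n => ?_
  cases n with
  | zero => exact ht
  | succ n => exact .refl _

theorem develop {t u : Lam} (h : Par t u) : Par u t.develop := by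
  induction h with
  | var n => exact .var n
  | @app s s' t t' hs _ ihs iht =>
    cases s with
    | var n => exact .app ihs iht
    | app a b => exact .app ihs iht
    | lam a =>
      cases hs with
      | lam ha =>
        cases ihs with
        | lam ihs => exact .beta ihs iht
  | lam _ ih => exact .lam ih
  | beta _ _ ihs iht => exact ihs.subst0 iht

end Par

theorem Beta.redApp {s s' t t' : Lam} (hs : ReflTransGen Beta s s') (ht : ReflTransGen Beta t t') :
    ReflTransGen Beta (.app s t) (.app s' t') :=
  (hs.lift (·.app t) fun _ _ h => .appL t h).trans (ht.lift (Lam.app s') fun _ _ h => .appR s' h)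

theorem Beta.redLam {t t' : Lam} (ht : ReflTransGen Beta t t') :
    ReflTransGen Beta (.lam t) (.lam t') :=
  ht.lift Lam.lam fun _ _ h => .lam h

theorem Par.red {t u : Lam} (h : Par t u) : ReflTransGen Beta t u := by
  induction h with
  | var n => exact .refl
  | app _ _ ihs iht => exact Beta.redApp ihs iht
  | lam _ ih => exact Beta.redLam ih
  | beta _ _ ihs iht => exact (Beta.redApp (Beta.redLam ihs) iht).tail (.beta _ _)

theorem Par.join_of_betaEq {t u : Lam} (h : BetaEq t u) : Join (ReflTransGen Par) t u := by
  have cr : ∀ a b c, Par a b → Par a c → ∃ d, ReflGen Par b d ∧ ReflTransGen Par c d :=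
    fun a _ _ hb hc => ⟨a.develop, .single hb.develop, .single hc.develop⟩
  have eqv := equivalence_join_reflTransGen cr
  induction h with
  | rel _ _ h => exact ⟨_, .single (Par.of_beta h), .refl⟩
  | refl _ => exact eqv.refl _
  | symm _ _ _ ih => exact eqv.symm ih
  | trans _ _ _ _ _ ih₁ ih₂ => exact eqv.trans ih₁ ih₂

theorem BetaEq.red_of_normalForm {t u : Lam} (h : BetaEq t u) (hu : NormalForm u) :
    ReflTransGen Beta t u := by
  obtain ⟨v, htv, huv⟩ := Par.join_of_betaEq h
  have red : ∀ {a b : Lam}, ReflTransGen Par a b → ReflTransGen Beta a b := by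
    intro a b h
    induction h with
    | refl => exact .refl
    | tail _ h ih => exact ih.trans h.red
  rcases (red huv).cases_head with rfl | ⟨w, hw, _⟩
  · exact red htv
  · exact (hu w hw).elim

theorem BetaEq.of_red {t u : Lam} (h : ReflTransGen Beta t u) : BetaEq t u := by
  induction h with
  | refl => exact .refl _
  | tail _ h ih => exact .trans _ _ _ ih (.rel _ _ h)

theorem normalForm_church (n : ℕ) : NormalForm (church n) := by
  have body : ∀ n u, ¬ Beta (churchBody n) u := by
    intro n
    induction n with
    | zero => intro u h; cases h
    | succ n ih =>
      intro u h
      cases h with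
      | appL _ h => cases h
      | appR _ h => exact ih _ h
  intro u h
  cases h with
  | lam h => cases h with | lam h => exact body n _ h

/-! ### Replacing subterms headed by a free variable -/

namespace Lam

/-- The number of nodes of a term. -/
def size : Lam → ℕ
  | var _ => 1
  | app s t => s.size + t.size + 1
  | lam t => t.size + 1

/-- The number of arguments to which the head of a term is applied. -/
def nargs : Lam → ℕ
  | app s _ => s.nargs + 1
  | _ => 0

/-- The term is a variable of index at least `k` applied to some arguments. -/
def Neutral (k : ℕ) : Lam → Prop
  | var i => k ≤ i
  | app s _ => s.Neutral k
  | lam _ => False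

theorem nargs_ren (ξ : ℕ → ℕ) (t : Lam) : (t.ren ξ).nargs = t.nargs := by
  induction t generalizing ξ with
  | var n => rfl
  | app s t ihs _ => simp only [ren, nargs, ihs]
  | lam t _ => rfl

theorem nargs_lt_size (t : Lam) : t.nargs < t.size := by
  induction t with
  | var n => simp [nargs, size]
  | app s t ihs _ => simp only [nargs, size]; omega
  | lam t _ => simp [nargs, size]

theorem Neutral.subst {k j : ℕ} {t : Lam} (ht : t.Neutral k) {σ : ℕ → Lam}
    (hσ : ∀ i, k ≤ i → (σ i).Neutral j) : (t.subst σ).Neutral j := by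
  induction t with
  | var n => exact hσ n ht
  | app s t ihs _ => exact ihs ht
  | lam t _ => exact ht.elim

theorem Neutral.ren {k j : ℕ} {t : Lam} (ht : t.Neutral k) {ξ : ℕ → ℕ}
    (hξ : ∀ i, k ≤ i → j ≤ ξ i) : (t.ren ξ).Neutral j := by
  rw [ren_eq_subst]
  exact ht.subst hξ

theorem Neutral.beta {k : ℕ} {t u : Lam} (ht : t.Neutral k) (h : Beta t u) : u.Neutral k := by
  induction h with
  | beta t u => exact ht.elim
  | appL _ _ ih => exact ih ht
  | appR _ _ _ => exact ht
  | lam _ _ => exact ht.elim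

theorem nargs_subst {k : ℕ} {t : Lam} (ht : ¬ t.Neutral k) {σ : ℕ → Lam}
    (hσ : ∀ i < k, σ i = var i) : (t.subst σ).nargs = t.nargs := by
  induction t with
  | var n => simp only [subst, hσ n (not_le.mp ht)]
  | app s t ihs _ => simp only [subst, nargs, ihs ht]
  | lam t _ => rfl

end Lam

/-- `Repl k s t`: the term `t` is obtained from `s` by replacing some subterms headed by a free
variable of `s` by arbitrary terms, the variables below `k` being considered as bound. -/
inductive Repl : ℕ → Lam → Lam → Prop
  | neutral {k s} (t) : s.Neutral k → Repl k s t
  | var (k i) : Repl k (.var i) (.var i)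
  | app {k s s' t t'} : Repl k s s' → Repl k t t' → Repl k (.app s t) (.app s' t')
  | lam {k t t'} : Repl (k + 1) t t' → Repl k (.lam t) (.lam t')

namespace Repl

theorem ren {k j : ℕ} {s t : Lam} (h : Repl k s t) {ξ : ℕ → ℕ} (hξ : ∀ i, k ≤ i → j ≤ ξ i) :
    Repl j (s.ren ξ) (t.ren ξ) := by
  induction h generalizing j ξ with
  | neutral t hs => exact .neutral _ (hs.ren hξ)
  | var k i => exact .var _ _
  | app _ _ ihs iht => exact .app (ihs hξ) (iht hξ)
  | lam _ ih =>
    refine .lam (ih fun i hi => ?_)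
    cases i with
    | zero => omega
    | succ i => exact Nat.succ_le_succ (hξ i (by omega))

theorem subst {k j : ℕ} {s t : Lam} (h : Repl k s t) {σ ρ : ℕ → Lam}
    (hn : ∀ i, k ≤ i → (σ i).Neutral j) (hr : ∀ i, Repl j (σ i) (ρ i)) :
    Repl j (s.subst σ) (t.subst ρ) := by
  induction h generalizing j σ ρ with
  | neutral t hs => exact .neutral _ (hs.subst hn)
  | var k i => exact hr i
  | app _ _ ihs iht => exact .app (ihs hn hr) (iht hn hr)
  | lam _ ih =>
    refine .lam (ih (fun i hi => ?_) fun i => ?_)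
    · cases i with
      | zero => omega
      | succ i =>
        simp only [Lam.up, Lam.lift_zero]
        exact (hn i (by omega)).ren fun i hi => by omega
    · cases i with
      | zero => exact .var _ _
      | succ i =>
        simp only [Lam.up, Lam.lift_zero]
        exact (hr i).ren fun i hi => by omega

theorem subst0 {k : ℕ} {s s' t t' : Lam} (hs : Repl (k + 1) s s') (ht : Repl k t t') :
    Repl k (s.subst0 t) (s'.subst0 t') := by
  rw [Lam.subst0_eq_subst_inst, Lam.subst0_eq_subst_inst]
  refine hs.subst (fun i hi => ?_) fun i => ?_
  · cases i with
    | zero => omega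
    | succ i => exact Nat.le_of_succ_le_succ hi
  · cases i with
    | zero => exact ht
    | succ i => exact .var _ _

theorem beta {k : ℕ} {s t u : Lam} (h : Repl k s t) (hb : Beta s u) :
    ∃ v, ReflTransGen Beta t v ∧ Repl k u v := by
  induction hb generalizing k t with
  | beta a b =>
    cases h with
    | neutral _ hs => exact hs.elim
    | app ha hb =>
      cases ha with
      | neutral _ hs => exact hs.elim
      | lam ha => exact ⟨_, .single (.beta _ _), ha.subst0 hb⟩
  | appL b hb ih =>
    cases h with
    | neutral _ hs => exact ⟨t, .refl, .neutral _ (hs.beta (.appL b hb))⟩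
    | app ha hb =>
      obtain ⟨v, hv, hr⟩ := ih ha
      exact ⟨_, Beta.redApp hv .refl, .app hr hb⟩
  | appR a hb ih =>
    cases h with
    | neutral _ hs => exact ⟨t, .refl, .neutral _ (hs.beta (.appR a hb))⟩
    | app ha hb =>
      obtain ⟨v, hv, hr⟩ := ih hb
      exact ⟨_, Beta.redApp .refl hv, .app ha hr⟩
  | lam _ ih =>
    cases h with
    | neutral _ hs => exact hs.elim
    | lam ha =>
      obtain ⟨v, hv, hr⟩ := ih ha
      exact ⟨_, Beta.redLam hv, .lam hr⟩

theorem red {k : ℕ} {s t u : Lam} (h : Repl k s t) (hb : ReflTransGen Beta s u) :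
    ∃ v, ReflTransGen Beta t v ∧ Repl k u v := by
  induction hb with
  | refl => exact ⟨t, .refl, h⟩
  | tail _ hb ih =>
    obtain ⟨v, hv, hr⟩ := ih
    obtain ⟨w, hw, hr'⟩ := hr.beta hb
    exact ⟨w, hv.trans hw, hr'⟩

theorem eq_church {n : ℕ} {t : Lam} (h : Repl 0 (church n) t) : t = church n := by
  have body : ∀ n t, Repl 2 (churchBody n) t → t = churchBody n := by
    intro n
    induction n with
    | zero =>
      intro t h
      cases h with
      | neutral _ hs => simp [churchBody, Lam.Neutral] at hs
      | var => rfl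
    | succ n ih =>
      intro t h
      cases h with
      | neutral _ hs => simp [churchBody, Lam.Neutral] at hs
      | app ha hb =>
        cases ha with
        | neutral _ hs => simp [Lam.Neutral] at hs
        | var => rw [ih _ hb]; rfl
  cases h with
  | neutral _ hs => exact hs.elim
  | lam h =>
    cases h with
    | neutral _ hs => exact hs.elim
    | lam h => rw [body n _ h]; rfl

/-- If the values of `σ` on free variables are variables or terms with many arguments, then an
instance of `t` by `σ` can only be an instance of `s` if `t` is `s` up to the subterms of `s`
headed by a free variable. -/
theorem of_subst_eq {M k : ℕ} {s t : Lam} {σ ρ : ℕ → Lam} (hs : s.size ≤ M)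
    (hσ : ∀ i < k, σ i = .var i)
    (hσ' : ∀ i, k ≤ i → (∃ j, k ≤ j ∧ σ i = .var j) ∨ M < (σ i).nargs)
    (hρ : ∀ i < k, ρ i = .var i) (h : t.subst σ = s.subst ρ) : Repl k s t := by
  induction s generalizing k t σ ρ with
  | var i =>
    by_cases hi : k ≤ i
    · exact .neutral _ hi
    rw [Lam.subst, hρ i (not_le.mp hi)] at h
    cases t with
    | var j =>
      simp only [Lam.subst] at h
      by_cases hj : k ≤ j
      · rcases hσ' j hj with ⟨l, hl, e⟩ | e
        · rw [e] at h
          cases h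
          exact (hi hl).elim
        · rw [h] at e
          simp [Lam.nargs] at e
      · rw [hσ j (not_le.mp hj)] at h
        cases h
        exact .var _ _
    | app a b => simp [Lam.subst] at h
    | lam a => simp [Lam.subst] at h
  | app s₁ s₂ ih₁ ih₂ =>
    simp only [Lam.size] at hs
    by_cases hn : (Lam.app s₁ s₂).Neutral k
    · exact .neutral _ hn
    cases t with
    | var j =>
      have hargs := Lam.nargs_subst hn hρ
      have hlt := (Lam.app s₁ s₂).nargs_lt_size
      rw [← h] at hargs
      simp only [Lam.subst, Lam.size] at h hargs hlt
      by_cases hj : k ≤ j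
      · rcases hσ' j hj with ⟨l, hl, e⟩ | e
        · rw [e] at h
          cases h
        · omega
      · rw [hσ j (not_le.mp hj)] at h
        cases h
    | app a b =>
      simp only [Lam.subst, Lam.app.injEq] at h
      exact .app (ih₁ (by omega) hσ hσ' hρ h.1) (ih₂ (by omega) hσ hσ' hρ h.2)
    | lam a => simp [Lam.subst] at h
  | lam s ih =>
    simp only [Lam.size] at hs
    cases t with
    | var j =>
      simp only [Lam.subst] at h
      by_cases hj : k ≤ j
      · rcases hσ' j hj with ⟨l, hl, e⟩ | e
        · rw [e] at h
          cases h
        · rw [h] at e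
          simp [Lam.nargs] at e
      · rw [hσ j (not_le.mp hj)] at h
        cases h
    | app a b => simp [Lam.subst] at h
    | lam a =>
      simp only [Lam.subst, Lam.lam.injEq] at h
      refine .lam (ih (by omega) (fun i hi => ?_) (fun i hi => ?_) (fun i hi => ?_) h)
      · cases i with
        | zero => rfl
        | succ i => simp [Lam.up, hσ i (by omega), Lam.lift]
      · cases i with
        | zero => omega
        | succ i =>
          simp only [Lam.up, Lam.lift_zero, Lam.nargs_ren]
          rcases hσ' i (by omega) with ⟨l, hl, e⟩ | e
          · exact .inl ⟨l + 1, by omega, by rw [e]; rfl⟩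
          · exact .inr e
      · cases i with
        | zero => rfl
        | succ i => simp [Lam.up, hρ i (by omega), Lam.lift]

end Repl

theorem betaEq_church_of_subst_eq {M n : ℕ} {s t : Lam} {σ ρ : ℕ → Lam} (hs : s.size ≤ M)
    (hσ : ∀ i, (∃ j, σ i = .var j) ∨ M < (σ i).nargs) (hc : BetaEq s (church n))
    (h : t.subst σ = s.subst ρ) : BetaEq t (church n) := by
  have hr : Repl 0 s t := by
    refine .of_subst_eq hs (fun i hi => by omega) (fun i _ => ?_) (fun i hi => by omega) h
    exact (hσ i).imp_left fun ⟨j, hj⟩ => ⟨j, j.zero_le, hj⟩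
  obtain ⟨v, hv, hr'⟩ := hr.red (hc.red_of_normalForm (normalForm_church n))
  rw [← hr'.eq_church]
  exact .of_red hv

/-! ### Iterated application -/

theorem appList_append (t : Lam) (c : List Lam) (u : Lam) :
    appList t (c ++ [u]) = .app (appList t c) u := by
  induction c generalizing t with
  | nil => rfl
  | cons a c ih => exact ih _

theorem appList_subst (σ : ℕ → Lam) (t : Lam) (c : List Lam) :
    (appList t c).subst σ = appList (t.subst σ) (c.map (·.subst σ)) := by
  induction c generalizing t with
  | nil => rfl
  | cons a c ih => exact ih _

theorem freeIn_appList {m : ℕ} {t : Lam} {c : List Lam} :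
    (appList t c).FreeIn m ↔ t.FreeIn m ∨ ∃ d ∈ c, d.FreeIn m := by
  induction c generalizing t with
  | nil => simp [appList]
  | cons a c ih => simp [appList, ih, Lam.FreeIn, or_assoc]

theorem nargs_appList (t : Lam) (c : List Lam) : (appList t c).nargs = t.nargs + c.length := by
  induction c generalizing t with
  | nil => rfl
  | cons a c ih => simp only [appList, ih, Lam.nargs, List.length_cons]; omega

theorem appList_ne_lam {t : Lam} (c : List Lam) (ht : ∀ s, t ≠ .lam s) (s : Lam) :
    appList t c ≠ .lam s := by
  induction c generalizing t with
  | nil => exact ht s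
  | cons a c ih => exact ih (by simp)

theorem appList_var_normal (y : ℕ) (c : List Lam) (w : Lam) : ¬ WStep (appList (.var y) c) w := by
  induction c using List.reverseRecOn generalizing w with
  | nil => intro h; cases h
  | append_singleton c a ih =>
    rw [appList_append]
    intro h
    generalize hs : appList (.var y) c = s at h ih
    cases h with
    | beta t u => exact appList_ne_lam c (by simp) _ hs
    | app _ h => exact ih _ h

theorem WRed.appList {t u : Lam} (h : WRed t u) (c : List Lam) :
    WRed (appList t c) (appList u c) := by
  induction c generalizing t u with
  | nil => exact h
  | cons a c ih => exact ih (h.app a)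

theorem WStep.transGen_appList {t u : Lam} (h : TransGen WStep t u) (c : List Lam) :
    TransGen WStep (_root_.appList t c) (_root_.appList u c) := by
  induction c generalizing t u with
  | nil => exact h
  | cons a c ih => exact ih (h.lift (·.app a) fun _ _ h => h.app a)

theorem wStep_or_lam_or_appList (t : Lam) :
    (∃ u, WStep t u) ∨ (∃ s, t = .lam s) ∨ ∃ y c, t = appList (.var y) c := by
  induction t with
  | var n => exact .inr (.inr ⟨n, [], rfl⟩)
  | lam t _ => exact .inr (.inl ⟨t, rfl⟩)
  | app s t ih _ =>
    rcases ih with ⟨u, hu⟩ | ⟨s, rfl⟩ | ⟨y, c, rfl⟩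
    · exact .inl ⟨_, hu.app t⟩
    · exact .inl ⟨_, .beta s t⟩
    · exact .inr (.inr ⟨y, c ++ [t], (appList_append _ _ _).symm⟩)

/-! ### Unfolding the iterates of a numeral -/

/-- The weak head reduct of the `l`-th iterate of `b` on `a`, where `W l a b` stands for that
iterate. -/
def unfoldIter (W : ℕ → Lam → Lam → Lam) (l : ℕ) (a b : Lam) : Lam :=
  if l = 0 then a else .app b (W (l - 1) a b)

/-- The substitution of `b` for the variable `0` and `a` for the variable `1`. -/
def inst₂ (a b : Lam) : ℕ → Lam
  | 0 => b
  | 1 => a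
  | n + 2 => .var n

theorem wRed_app_app {θ p q : Lam} (h : WRed θ (.lam p)) (h' : WRed p (.lam q)) (a b : Lam) :
    TransGen WStep (.app (.app θ a) b) (q.subst (inst₂ a b)) := by
  have h₁ : WRed (.app θ a) (.lam (q.subst (Lam.up (Lam.inst a)))) := by
    refine ((h.app a).tail (.beta _ _)).trans ?_
    rw [Lam.subst0_eq_subst_inst]
    exact h'.subst _
  have h₂ := TransGen.tail' (h₁.app b) (.beta _ _)
  rw [Lam.subst_up_subst0] at h₂
  convert h₂ using 2
  funext n
  rcases n with _ | _ | n <;> rfl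

theorem exists_iterates {n : ℕ} {q : Lam} (h : Std q (churchBody n)) :
    ∃ w : ℕ → Lam, w n = q ∧ WRed (w 0) (.var 1) ∧
      ∀ l < n, WRed (w (l + 1)) (.app (.var 0) (w l)) := by
  induction n generalizing q with
  | zero =>
    cases h with
    | var _ h => exact ⟨fun _ => q, rfl, h, fun l hl => by omega⟩
  | succ n ih =>
    cases h with
    | app h hv hr =>
      cases hv with
      | var _ hv =>
        obtain ⟨w, hw, h₀, hs⟩ := ih hr
        refine ⟨Function.update w (n + 1) q, by simp, by simpa using h₀, fun l hl => ?_⟩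
        rcases Nat.lt_succ_iff_lt_or_eq.mp hl with hl | rfl
        · rw [Function.update_of_ne (by omega), Function.update_of_ne (by omega)]
          exact hs l hl
        · rw [Function.update_self, Function.update_of_ne (by omega), hw]
          exact h.trans (hv.app _)

theorem exists_unfolding {n : ℕ} {θ : Lam} (h : BetaEq θ (church n)) :
    ∃ W : ℕ → Lam → Lam → Lam, (∀ a b, WRed (.app (.app θ a) b) (unfoldIter W n a b)) ∧
      ∀ l < n, ∀ a b, WRed (W l a b) (unfoldIter W l a b) := by
  cases Std.of_beta (h.red_of_normalForm (normalForm_church n)) with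
  | lam h hp =>
    cases hp with
    | lam h' hq =>
      obtain ⟨w, rfl, h₀, hs⟩ := exists_iterates hq
      have key : ∀ l ≤ n, ∀ a b, WRed ((w l).subst (inst₂ a b))
          (unfoldIter (fun l a b => (w l).subst (inst₂ a b)) l a b) := by
        intro l hl a b
        cases l with
        | zero => exact h₀.subst _
        | succ l => exact (hs l (by omega)).subst _
      exact ⟨_, fun a b => (wRed_app_app h h' a b).to_reflTransGen.trans (key n le_rfl a b),
        fun l hl => key l hl.le⟩

/-! ### A numeral whose iterates have many arguments -/

/-- The identity applied `m` times to itself. -/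
def idSpine : ℕ → Lam
  | 0 => .lam (.var 0)
  | m + 1 => .app (idSpine m) (.lam (.var 0))

/-- A weak head expansion of `t` with `m + 1` arguments. -/
def pad (m : ℕ) (t : Lam) : Lam := .app (idSpine m) t

theorem idSpine_subst (σ : ℕ → Lam) (m : ℕ) : (idSpine m).subst σ = idSpine m := by
  induction m with
  | zero => rfl
  | succ m ih => simp [idSpine, Lam.subst, ih, Lam.up]

theorem pad_subst (σ : ℕ → Lam) (m : ℕ) (t : Lam) : (pad m t).subst σ = pad m (t.subst σ) := by
  simp only [pad, Lam.subst, idSpine_subst]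

theorem nargs_pad (m : ℕ) (t : Lam) : (pad m t).nargs = m + 1 := by
  have : (idSpine m).nargs = m := by
    induction m with
    | zero => rfl
    | succ m ih => simp [idSpine, Lam.nargs, ih]
  simp [pad, Lam.nargs, this]

theorem pad_wRed (m : ℕ) (t : Lam) : TransGen WStep (pad m t) t := by
  have h : WRed (idSpine m) (.lam (.var 0)) := by
    induction m with
    | zero => exact .refl
    | succ m ih => exact (ih.app _).tail (.beta _ _)
  exact .tail' (h.app t) (.beta _ _)

theorem pad_red (m : ℕ) (t : Lam) : ReflTransGen Beta (pad m t) t :=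
  (pad_wRed m t).to_reflTransGen.lift id fun _ _ h => h.beta_step

/-- The body of `church l` with every subterm in the iteration padded. -/
def padBody (m : ℕ) : ℕ → Lam
  | 0 => pad m (.var 1)
  | l + 1 => pad m (.app (.var 0) (padBody m l))

/-- The numeral `church n`, padded. -/
def padChurch (m n : ℕ) : Lam := pad m (.lam (.lam (padBody m n)))

/-- The padded iterates. -/
def padIter (m l : ℕ) (a b : Lam) : Lam := (padBody m l).subst (inst₂ a b)

theorem betaEq_padChurch (m n : ℕ) : BetaEq (padChurch m n) (church n) := by
  have body : ∀ l, ReflTransGen Beta (padBody m l) (churchBody l) := by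
    intro l
    induction l with
    | zero => exact pad_red _ _
    | succ l ih => exact (pad_red _ _).trans (Beta.redApp .refl ih)
  exact .of_red ((pad_red _ _).trans (Beta.redLam (Beta.redLam (body n))))

theorem nargs_padIter (m l : ℕ) (a b : Lam) : (padIter m l a b).nargs = m + 1 := by
  cases l <;> simp only [padIter, padBody, pad_subst, nargs_pad]

theorem padIter_wRed (m l : ℕ) (a b : Lam) :
    TransGen WStep (padIter m l a b) (unfoldIter (padIter m) l a b) := by
  cases l <;> simp only [padIter, padBody, pad_subst] <;> exact pad_wRed _ _

theorem padChurch_app_app_wRed (m n : ℕ) (a b : Lam) :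
    TransGen WStep (.app (.app (padChurch m n) a) b) (unfoldIter (padIter m) n a b) :=
  (wRed_app_app (pad_wRed _ _).to_reflTransGen .refl a b).trans (padIter_wRed m n a b)

theorem padChurch_wRed (m n : ℕ) : ∃ s, WRed (padChurch m n) (.lam s) :=
  ⟨_, (pad_wRed _ _).to_reflTransGen⟩

theorem padChurch_app_wRed (m n : ℕ) (a : Lam) : ∃ s, WRed (.app (padChurch m n) a) (.lam s) :=
  ⟨_, (WRed.app (pad_wRed _ _).to_reflTransGen a).tail (.beta _ _)⟩

/-! ### Fresh variables -/

/-- An injective numbering of terms. -/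
def Lam.code : Lam → ℕ
  | var n => 3 * n
  | app s t => 3 * Nat.pair s.code t.code + 1
  | lam t => 3 * t.code + 2

theorem Lam.code_injective : Function.Injective Lam.code := by
  intro t
  induction t with
  | var n =>
    intro u h
    cases u <;> simp only [code] at h <;> first | omega | (congr 1; omega)
  | app s t ihs iht =>
    intro u h
    cases u with
    | app a b =>
      simp only [code] at h
      have := Nat.pair_eq_pair.mp (show Nat.pair s.code t.code = Nat.pair a.code b.code by omega)
      rw [ihs this.1, iht this.2]
    | var _ => simp only [code] at h; omega
    | lam _ => simp only [code] at h; omega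
  | lam t ih =>
    intro u h
    cases u with
    | lam a => simp only [code] at h; rw [ih (by omega : t.code = a.code)]
    | var _ => simp only [code] at h; omega
    | app _ _ => simp only [code] at h; omega

/-- A strict upper bound on the free variables of a term. -/
def Lam.varBound : Lam → ℕ
  | var n => n + 1
  | app s t => max s.varBound t.varBound
  | lam t => t.varBound

theorem Lam.FreeIn.lt_varBound {m : ℕ} {t : Lam} (h : t.FreeIn m) : m < t.varBound := by
  induction t generalizing m with
  | var n => exact h ▸ Nat.lt_succ_self _
  | app s t ihs iht => exact lt_max_iff.mpr (h.imp ihs iht)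
  | lam t ih => exact (Nat.lt_succ_self m).trans (ih h)

/-- `X` is an injective choice of variables other than `0` and `1`, fresh for their indices. -/
structure FreshVars (X : ℕ → Lam → Lam → List Lam → ℕ) : Prop where
  inj : ∀ l a b c l' a' b' c', X l a b c = X l' a' b' c' → l = l' ∧ a = a' ∧ b = b' ∧ c = c'
  fresh : ∀ l a b c, 2 ≤ X l a b c ∧ ¬ a.FreeIn (X l a b c) ∧ ¬ b.FreeIn (X l a b c) ∧
    ∀ d ∈ c, ¬ d.FreeIn (X l a b c)

theorem exists_freshVars : ∃ X, FreshVars X := by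
  have : Countable Lam := Lam.code_injective.countable
  obtain ⟨e, he⟩ := exists_injective_nat (ℕ × Lam × Lam × List Lam)
  let B : Lam → Lam → List Lam → ℕ := fun a b c => (appList (.app a b) c).varBound
  have hB : ∀ l a b c m, (appList (.app a b) c).FreeIn m →
      m ≠ Nat.pair (e (l, a, b, c)) (B a b c) + 2 := by
    intro l a b c m hm
    have h₁ := hm.lt_varBound
    have h₂ := Nat.right_le_pair (e (l, a, b, c)) (B a b c)
    simp only [B] at h₂ ⊢
    omega
  refine ⟨fun l a b c => Nat.pair (e (l, a, b, c)) (B a b c) + 2, ?_, ?_⟩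
  · intro l a b c l' a' b' c' h
    have := he (Nat.pair_eq_pair.mp (Nat.add_right_cancel h)).1
    simpa using this
  · intro l a b c
    refine ⟨by omega, fun h => ?_, fun h => ?_, fun d hd h => ?_⟩
    · exact hB l a b c _ (freeIn_appList.mpr (.inl (.inl h))) rfl
    · exact hB l a b c _ (freeIn_appList.mpr (.inl (.inr h))) rfl
    · exact hB l a b c _ (freeIn_appList.mpr (.inr ⟨d, hd, h⟩)) rfl

/-! ### Interpreting the fresh variables by iterates -/

/-- The term that follows `appList (var (X l a b c)) c` in the sequence of head reductions. -/
def unfoldVar (X : ℕ → Lam → Lam → List Lam → ℕ) (l : ℕ) (a b : Lam) (c : List Lam) : Lam :=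
  if l = 0 then appList a c else appList (.app b (.var (X (l - 1) a b c))) c

/-- `σ` maps the variable `1` to `θ`, and the fresh variables in `S` to the iterates `W`. -/
structure Interp (X : ℕ → Lam → Lam → List Lam → ℕ) (n : ℕ) (W : ℕ → Lam → Lam → Lam) (θ : Lam)
    (S : Set ℕ) (σ : ℕ → Lam) : Prop where
  zero_mem : 0 ∈ S
  one_mem : 1 ∈ S
  map_zero : σ 0 = .var 0
  map_one : σ 1 = θ
  map_fresh : ∀ y ∈ S, 2 ≤ y → ∃ l a b c, y = X l a b c ∧ l < n ∧
    (∀ m, a.FreeIn m → m ∈ S) ∧ (∀ m, b.FreeIn m → m ∈ S) ∧ σ y = W l (a.subst σ) (b.subst σ)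

namespace Interp

variable {X : ℕ → Lam → Lam → List Lam → ℕ} {n : ℕ} {W : ℕ → Lam → Lam → Lam} {θ : Lam}
  {S : Set ℕ} {σ : ℕ → Lam}

theorem base (X : ℕ → Lam → Lam → List Lam → ℕ) (n : ℕ) (W : ℕ → Lam → Lam → Lam) (θ : Lam) :
    Interp X n W θ {0, 1} (Function.update .var 1 θ) where
  zero_mem := by simp
  one_mem := by simp
  map_zero := by simp
  map_one := by simp
  map_fresh y hy h := by
    rcases hy with rfl | rfl <;> omega

theorem map_freshVar (hX : FreshVars X) (h : Interp X n W θ S σ) {l : ℕ} {a b : Lam}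
    {c : List Lam} (hy : X l a b c ∈ S) :
    l < n ∧ (∀ m, a.FreeIn m → m ∈ S) ∧ (∀ m, b.FreeIn m → m ∈ S) ∧
      σ (X l a b c) = W l (a.subst σ) (b.subst σ) := by
  obtain ⟨l', a', b', c', e, hl, ha, hb, hσ⟩ := h.map_fresh _ hy (hX.fresh l a b c).1
  obtain ⟨rfl, rfl, rfl, rfl⟩ := hX.inj _ _ _ _ _ _ _ _ e
  exact ⟨hl, ha, hb, hσ⟩

theorem extend (hX : FreshVars X) (h : Interp X n W θ S σ) {l : ℕ} {a b : Lam} (c : List Lam)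
    (hl : l < n) (ha : ∀ m, a.FreeIn m → m ∈ S) (hb : ∀ m, b.FreeIn m → m ∈ S)
    {K : Lam → Prop} (hK : ∀ l a b, K (W l a b)) (hσ : ∀ y, K (σ y)) :
    ∃ S' σ', Interp X n W θ S' σ' ∧ S ⊆ S' ∧ X l a b c ∈ S' ∧ (∀ y ∈ S, σ' y = σ y) ∧
      σ' (X l a b c) = W l (a.subst σ) (b.subst σ) ∧ ∀ y, K (σ' y) := by
  by_cases hy : X l a b c ∈ S
  · exact ⟨S, σ, h, subset_rfl, hy, fun _ _ => rfl, (h.map_freshVar hX hy).2.2.2, hσ⟩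
  set x := X l a b c with hx
  have hx₂ : 2 ≤ x := (hX.fresh l a b c).1
  set σ' := Function.update σ x (W l (a.subst σ) (b.subst σ)) with hσ'
  have heq : ∀ y ∈ S, σ' y = σ y := fun y hyS =>
    Function.update_of_ne (fun e => hy (by rwa [← e])) _ _
  have hsub : ∀ t : Lam, (∀ m, t.FreeIn m → m ∈ S) → t.subst σ' = t.subst σ := fun t ht =>
    Lam.subst_congr fun m hm => heq m (ht m hm)
  have hself : σ' x = W l (a.subst σ) (b.subst σ) := Function.update_self ..
  refine ⟨insert x S, σ', ⟨.inr h.zero_mem, .inr h.one_mem, ?_, ?_, ?_⟩, Set.subset_insert _ _,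
    .inl rfl, heq, hself, fun y => ?_⟩
  · rw [heq 0 h.zero_mem, h.map_zero]
  · rw [heq 1 h.one_mem, h.map_one]
  · rintro y (rfl | hyS) hy₂
    · exact ⟨l, a, b, c, hx, hl, fun m hm => .inr (ha m hm), fun m hm => .inr (hb m hm),
        by rw [hself, hsub a ha, hsub b hb]⟩
    · obtain ⟨l', a', b', c', e, hl', ha', hb', hv⟩ := h.map_fresh y hyS hy₂
      exact ⟨l', a', b', c', e, hl', fun m hm => .inr (ha' m hm), fun m hm => .inr (hb' m hm),
        by rw [heq y hyS, hsub a' ha', hsub b' hb', hv]⟩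
  · by_cases e : y = x
    · rw [e, hself]; exact hK _ _ _
    · rw [hσ', Function.update_of_ne e]; exact hσ y

theorem unfold (hX : FreshVars X) (h : Interp X n W θ S σ) {l : ℕ} {a b : Lam} {c : List Lam}
    (hl : l ≤ n) (ha : ∀ m, a.FreeIn m → m ∈ S) (hb : ∀ m, b.FreeIn m → m ∈ S)
    (hc : ∀ d ∈ c, ∀ m, d.FreeIn m → m ∈ S)
    {K : Lam → Prop} (hK : ∀ l a b, K (W l a b)) (hσ : ∀ y, K (σ y)) :
    ∃ S' σ', Interp X n W θ S' σ' ∧ (∀ m, (unfoldVar X l a b c).FreeIn m → m ∈ S') ∧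
      (unfoldVar X l a b c).subst σ' =
        appList (unfoldIter W l (a.subst σ) (b.subst σ)) (c.map (·.subst σ)) ∧
      ∀ y, K (σ' y) := by
  cases l with
  | zero =>
    refine ⟨S, σ, h, fun m hm => ?_, by simp [unfoldVar, unfoldIter, appList_subst], hσ⟩
    simp only [unfoldVar, if_true] at hm
    rcases freeIn_appList.mp hm with hm | ⟨d, hd, hm⟩
    · exact ha m hm
    · exact hc d hd m hm
  | succ l =>
    obtain ⟨S', σ', h', hS, hx, heq, hself, hσ'⟩ := h.extend hX c (Nat.lt_of_succ_le hl) ha hb hK hσ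
    refine ⟨S', σ', h', fun m hm => ?_, ?_, hσ'⟩
    · simp only [unfoldVar, Nat.add_eq_zero_iff, one_ne_zero, and_false, if_false,
        Nat.add_sub_cancel] at hm
      rcases freeIn_appList.mp hm with (hm | hm) | ⟨d, hd, hm⟩
      · exact hS (hb m hm)
      · obtain rfl : X l a b c = m := hm
        exact hx
      · exact hS (hc d hd m hm)
    · have hsub : ∀ t : Lam, (∀ m, t.FreeIn m → m ∈ S) → t.subst σ' = t.subst σ := fun t ht =>
        Lam.subst_congr fun m hm => heq m (ht m hm)
      have hmap : c.map (·.subst σ') = c.map (·.subst σ) :=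
        List.map_congr_left fun d hd => hsub d (hc d hd)
      simp [unfoldVar, unfoldIter, appList_subst, Lam.subst, hself, hsub b hb, hmap]

end Interp

/-! ### Sequences of head reductions -/

/-- The relation between the end `v` of a head reduction and the start `u` of the next one. -/
def NextStart (X : ℕ → Lam → Lam → List Lam → ℕ) (n : ℕ) (v u : Lam) : Prop :=
  (∃ a b c, v = appList (.app (.app (.var 1) a) b) c ∧ u = unfoldVar X n a b c) ∨
    ∃ l a b c d, l < n ∧ v = appList (.var (X l a b c)) d ∧ u = unfoldVar X l a b d

/-- There is a sequence of head reductions from `u` to `(f)τ` with `τ` equivalent to `church n`. -/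
def HasRun (X : ℕ → Lam → Lam → List Lam → ℕ) (n : ℕ) (u : Lam) : Prop :=
  ∃ r : ℕ, 0 < r ∧ ∃ U V : ℕ → Lam, U 0 = u ∧ (∀ i < r, HRed (U i) (V i)) ∧
    (∃ τ : Lam, BetaEq τ (church n) ∧ V (r - 1) = .app (.var 0) τ) ∧
    ∀ i, i + 1 < r → NextStart X n (V i) (U (i + 1))

namespace HasRun

variable {X : ℕ → Lam → Lam → List Lam → ℕ} {n : ℕ}

theorem of_betaEq {t : Lam} (h : BetaEq t (church n)) : HasRun X n (.app (.var 0) t) :=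
  ⟨1, one_pos, fun _ => .app (.var 0) t, fun _ => .app (.var 0) t, rfl, fun _ _ => ⟨0, .refl _⟩,
    ⟨t, h, rfl⟩, fun i hi => by omega⟩

theorem head {u u' : Lam} (h : WStep u u') (hr : HasRun X n u') : HasRun X n u := by
  obtain ⟨r, hr, U, V, rfl, hUV, hτ, hn⟩ := hr
  refine ⟨r, hr, fun i => if i = 0 then u else U i, V, rfl, fun i hi => ?_, hτ, fun i hi => ?_⟩
  · rcases i with _ | i
    · obtain ⟨k, hk⟩ := hUV 0 hi
      exact ⟨k + 1, .step h.hStep hk⟩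
    · simpa using hUV (i + 1) hi
  · simpa using hn i hi

theorem cons {v u : Lam} (h : NextStart X n v u) (hr : HasRun X n u) : HasRun X n v := by
  obtain ⟨r, hr, U, V, rfl, hUV, ⟨τ, hτ, hV⟩, hn⟩ := hr
  refine ⟨r + 1, by omega, fun i => Nat.casesOn i v U, fun i => Nat.casesOn i v V, rfl,
    fun i hi => ?_, ⟨τ, hτ, ?_⟩, fun i hi => ?_⟩
  · rcases i with _ | i
    · exact ⟨0, .refl _⟩
    · exact hUV i (by omega)
  · obtain ⟨r, rfl⟩ : ∃ k, r = k + 1 := ⟨r - 1, by omega⟩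
    exact hV
  · rcases i with _ | i
    · exact h
    · exact hn i (by omega)

end HasRun

theorem wStep_normal_app_var (y : ℕ) (t w : Lam) : ¬ WStep (.app (.var y) t) w :=
  appList_var_normal y [t] w

/-- A head reduction of an instance of `u`, in which the fresh variables are interpreted by padded
iterates, yields a sequence of head reductions starting from `u`. -/
theorem Interp.hasRun {X : ℕ → Lam → Lam → List Lam → ℕ} (hX : FreshVars X) {n : ℕ} {τ : Lam}
    {ρ : ℕ → Lam} (hτ : BetaEq τ (church n)) {u : Lam} {S : Set ℕ} {σ : ℕ → Lam}
    (h : Interp X n (padIter τ.size) (padChurch τ.size n) S σ)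
    (hu : ∀ m, u.FreeIn m → m ∈ S) (hσ : ∀ y, (∃ j, σ y = .var j) ∨ τ.size < (σ y).nargs)
    (hred : WRed (u.subst σ) (.app (.var 0) (τ.subst ρ))) : HasRun X n u := by
  have hn := wStep_normal_app_var 0 (τ.subst ρ)
  have hacc : Acc (fun b a => TransGen WStep a b) (u.subst σ) := by
    have := (hred.acc hn).transGen
    refine Subrelation.accessible (fun {a b} hab => ?_) this
    exact transGen_swap.mpr hab
  let K : Lam → Prop := fun t => (∃ j, t = .var j) ∨ τ.size < t.nargs
  have hK : ∀ l a b, K (padIter τ.size l a b) := fun l a b =>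
    .inr (by rw [nargs_padIter]; omega)
  have not_lam : ∀ {t s : Lam}, WRed t (.app (.var 0) (τ.subst ρ)) → ¬ WRed t (.lam s) := by
    intro t s h h'
    have := h'.of_normal h hn
    rcases this.cases_head with e | ⟨w, hw, _⟩
    · cases e
    · exact hw.not_lam _ rfl
  generalize ht : u.subst σ = t at hacc
  induction hacc generalizing u S σ with
  | intro t _ ih =>
    subst ht
    rcases wStep_or_lam_or_appList u with ⟨u', hu'⟩ | ⟨s, rfl⟩ | ⟨y, c, rfl⟩
    · have hs := hu'.subst σ
      exact .head hu' (ih _ (.single hs) h (fun m hm => hu m (hu'.freeIn hm)) hσ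
        (WRed.of_normal (.single hs) hred hn) rfl)
    · exact (not_lam hred .refl).elim
    have hy : y ∈ S := hu y (freeIn_appList.mpr (.inl rfl))
    have hc : ∀ d ∈ c, ∀ m, d.FreeIn m → m ∈ S := fun d hd m hm =>
      hu m (freeIn_appList.mpr (.inr ⟨d, hd, hm⟩))
    rw [appList_subst, Lam.subst] at hred
    rw [appList_subst, Lam.subst] at ih
    rcases y with _ | _ | y
    · rw [h.map_zero] at hred
      rcases hred.cases_head with e | ⟨w, hw, _⟩
      · have hlen := congrArg Lam.nargs e
        simp only [nargs_appList, Lam.nargs, List.length_map] at hlen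
        obtain ⟨d, rfl⟩ := List.length_eq_one_iff.mp (by omega : c.length = 1)
        simp only [List.map, appList, Lam.app.injEq, true_and] at e
        exact .of_betaEq (betaEq_church_of_subst_eq le_rfl hσ hτ e)
      · exact (appList_var_normal _ _ _ hw).elim
    · simp only [zero_add] at hred ih hy ⊢
      rw [h.map_one] at hred ih
      rcases c with _ | ⟨a, _ | ⟨b, c⟩⟩
      · obtain ⟨s, hs⟩ := padChurch_wRed τ.size n
        exact (not_lam hred hs).elim
      · obtain ⟨s, hs⟩ := padChurch_app_wRed τ.size n (a.subst σ)
        exact (not_lam hred hs).elim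
      · obtain ⟨S', σ', h', hu', e, hσ'⟩ := h.unfold (c := c) (K := K) hX le_rfl
          (hc a (by simp)) (hc b (by simp)) (fun d hd => hc d (by simp [hd])) hK hσ
        have hs := WStep.transGen_appList
          (padChurch_app_app_wRed τ.size n (a.subst σ) (b.subst σ)) (c.map (·.subst σ))
        rw [← e] at hs
        exact .cons (.inl ⟨a, b, c, rfl, rfl⟩) (ih _ hs h' hu' hσ'
          (WRed.of_normal hs.to_reflTransGen hred hn) rfl)
    · obtain ⟨l, a, b, c', e, -⟩ := h.map_fresh _ hy (by omega)
      rw [e] at hy hred ih ⊢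
      obtain ⟨hl, ha, hb, hv⟩ := h.map_freshVar hX hy
      rw [hv] at hred ih
      obtain ⟨S', σ', h', hu', e, hσ'⟩ := h.unfold (K := K) hX hl.le ha hb hc hK hσ
      have hs := WStep.transGen_appList
        (padIter_wRed τ.size l (a.subst σ) (b.subst σ)) (c.map (·.subst σ))
      rw [← e] at hs
      exact .cons (.inr ⟨l, a, b, c', c, hl, rfl, rfl⟩) (ih _ hs h' hu' hσ'
        (WRed.of_normal hs.to_reflTransGen hred hn) rfl)

/-- The instance by `σ` of a step of the sequence is a weak head reduction. -/
theorem Interp.nextStart {X : ℕ → Lam → Lam → List Lam → ℕ} (hX : FreshVars X) {n : ℕ}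
    {W : ℕ → Lam → Lam → Lam} {θ : Lam} {S : Set ℕ} {σ : ℕ → Lam} (h : Interp X n W θ S σ)
    (hθ : ∀ a b, WRed (.app (.app θ a) b) (unfoldIter W n a b))
    (hW : ∀ l < n, ∀ a b, WRed (W l a b) (unfoldIter W l a b)) {u v v' : Lam}
    (hu : ∀ m, u.FreeIn m → m ∈ S) (huv : HRed u v) (hv : NextStart X n v v') :
    ∃ S' σ', Interp X n W θ S' σ' ∧ (∀ m, v'.FreeIn m → m ∈ S') ∧
      WRed (u.subst σ) (v'.subst σ') := by
  rcases hv with ⟨a, b, c, rfl, rfl⟩ | ⟨l, a, b, c, d, hl, rfl, rfl⟩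
  · have hw := huv.wRed (appList_ne_lam c (by simp))
    obtain ⟨S', σ', h', hu', e, -⟩ := h.unfold (K := fun _ => True) (c := c) hX le_rfl
      (fun m hm => hu m (hw.freeIn (freeIn_appList.mpr (.inl (.inl (.inr hm))))))
      (fun m hm => hu m (hw.freeIn (freeIn_appList.mpr (.inl (.inr hm)))))
      (fun x hx m hm => hu m (hw.freeIn (freeIn_appList.mpr (.inr ⟨x, hx, hm⟩))))
      (fun _ _ _ => trivial) fun _ => trivial
    refine ⟨S', σ', h', hu', (hw.subst σ).trans ?_⟩
    rw [e, appList_subst]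
    simp only [Lam.subst, h.map_one]
    exact (hθ _ _).appList _
  · have hw := huv.wRed (appList_ne_lam d (by simp))
    obtain ⟨-, ha, hb, hx⟩ := h.map_freshVar hX
      (hu _ (hw.freeIn (freeIn_appList.mpr (.inl rfl))))
    obtain ⟨S', σ', h', hu', e, -⟩ := h.unfold (K := fun _ => True) (c := d) hX hl.le ha hb
      (fun x hx m hm => hu m (hw.freeIn (freeIn_appList.mpr (.inr ⟨x, hx, hm⟩))))
      (fun _ _ _ => trivial) fun _ => trivial
    refine ⟨S', σ', h', hu', (hw.subst σ).trans ?_⟩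
    rw [e, appList_subst]
    simp only [Lam.subst, hx]
    exact (hW l hl _ _).appList _

theorem freeIn_start {T : Lam} (hT : T.Closed) (m : ℕ)
    (hm : (Lam.app (.app T (.var 1)) (.var 0)).FreeIn m) : m ∈ ({0, 1} : Set ℕ) := by
  rcases hm with (hm | hm) | hm
  · exact (hT m hm).elim
  · exact .inr hm.symm
  · exact .inl hm.symm

theorem subst_start {T : Lam} (hT : T.Closed) (θ : Lam) :
    (Lam.app (.app T (.var 1)) (.var 0)).subst (Function.update .var 1 θ) =
      .app (.app T θ) (.var 0) := by
  simp [Lam.subst, hT.subst_eq]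

theorem HasRun.exists_wRed {X : ℕ → Lam → Lam → List Lam → ℕ} (hX : FreshVars X) {T : Lam}
    (hT : T.Closed) {n : ℕ} (h : HasRun X n (.app (.app T (.var 1)) (.var 0))) :
    ∃ τ, BetaEq τ (church n) ∧ ∀ θ, BetaEq θ (church n) →
      ∃ σ, WRed (.app (.app T θ) (.var 0)) (.app (.var 0) (τ.subst σ)) := by
  obtain ⟨r, hr, U, V, hU, hUV, ⟨τ, hτ, hV⟩, hn⟩ := h
  refine ⟨τ, hτ, fun θ hθ => ?_⟩
  obtain ⟨W, hθ', hW⟩ := exists_unfolding hθ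
  have key : ∀ i < r, ∃ S σ, Interp X n W θ S σ ∧ (∀ m, (U i).FreeIn m → m ∈ S) ∧
      WRed (.app (.app T θ) (.var 0)) ((U i).subst σ) := by
    intro i
    induction i with
    | zero =>
      intro _
      refine ⟨_, _, .base X n W θ, ?_, ?_⟩
      · rw [hU]
        exact freeIn_start hT
      · rw [hU, subst_start hT]
    | succ i ih =>
      intro hi
      obtain ⟨S, σ, h, hu, hred⟩ := ih (by omega)
      obtain ⟨S', σ', h', hu', hred'⟩ :=
        h.nextStart hX hθ' hW hu (hUV i (by omega)) (hn i hi)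
      exact ⟨S', σ', h', hu', hred.trans hred'⟩
  obtain ⟨S, σ, h, -, hred⟩ := key (r - 1) (by omega)
  have hlast := hUV (r - 1) (by omega)
  rw [hV] at hlast
  refine ⟨σ, hred.trans ?_⟩
  have := (hlast.wRed (by simp)).subst σ
  rwa [Lam.subst, Lam.subst, h.map_zero] at this

/-- A closed λ-term `T` is a storage operator for the integers iff for every `n`
there is a finite sequence of head reductions `{Uᵢ ≻ Vᵢ}` as in Theorem 4.2
(here `ν = var 1`, `f = var 0`, and `X l a b c̄` is the fresh variable
`x_{l,a,b,c̄}`). -/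
theorem storage_operator_characterization (T : Lam) (hT : T.Closed) :
    IsStorage T ↔
      ∀ n : ℕ, ∃ r : ℕ, 0 < r ∧ ∃ U V : ℕ → Lam,
        ∃ X : ℕ → Lam → Lam → List Lam → ℕ,
          (∀ l a b c l' a' b' c', X l a b c = X l' a' b' c' →
              l = l' ∧ a = a' ∧ b = b' ∧ c = c') ∧
          (∀ l a b c, 2 ≤ X l a b c ∧ ¬ a.FreeIn (X l a b c) ∧
              ¬ b.FreeIn (X l a b c) ∧ ∀ d ∈ c, ¬ d.FreeIn (X l a b c)) ∧
          U 0 = .app (.app T (.var 1)) (.var 0) ∧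
          (∀ i < r, HRed (U i) (V i)) ∧
          (∃ τ : Lam, BetaEq τ (church n) ∧ V (r - 1) = .app (.var 0) τ) ∧
          (∀ i, i + 1 < r →
            (∃ a b c, V i = appList (.app (.app (.var 1) a) b) c ∧
                U (i + 1) = if n = 0 then appList a c
                  else appList (.app b (.var (X (n - 1) a b c))) c) ∨
            (∃ l a b c d, l < n ∧ V i = appList (.var (X l a b c)) d ∧
                U (i + 1) = if l = 0 then appList a d
                  else appList (.app b (.var (X (l - 1) a b d))) d)) := by
  constructor
  · intro h n
    obtain ⟨τ, hτ, hs⟩ := h n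
    obtain ⟨X, hX⟩ := exists_freshVars
    obtain ⟨ρ, hρ⟩ := hs _ (betaEq_padChurch τ.size n)
    have hrun : HasRun X n (.app (.app T (.var 1)) (.var 0)) := by
      refine (Interp.base X n (padIter τ.size) (padChurch τ.size n)).hasRun (ρ := ρ) hX hτ
        (freeIn_start hT) (fun y => ?_) ?_
      · by_cases hy : y = 1
        · rw [hy, Function.update_self, padChurch, nargs_pad]
          exact .inr (Nat.lt_succ_self _)
        · rw [Function.update_of_ne hy]
          exact .inl ⟨y, rfl⟩
      · rw [subst_start hT]
        exact hρ.wRed (by simp)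
    obtain ⟨r, hr, U, V, hU, hUV, hτ, hn⟩ := hrun
    exact ⟨r, hr, U, V, X, hX.inj, hX.fresh, hU, hUV, hτ, hn⟩
  · intro h n
    obtain ⟨r, hr, U, V, X, hinj, hfresh, hU, hUV, hτ, hn⟩ := h n
    have hrun : HasRun X n (.app (.app T (.var 1)) (.var 0)) := ⟨r, hr, U, V, hU, hUV, hτ, hn⟩
    obtain ⟨τ, hτ, hs⟩ := hrun.exists_wRed ⟨hinj, hfresh⟩ hT
    exact ⟨τ, hτ, fun θ hθ => (hs θ hθ).imp fun _ h => h.hRed⟩
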